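/- arXiv:0909.1678 — 10 statements merged into one kernel-verified Lean document; each statement's English description precedes it below -/
import Mathlib

section
/- Let P_f be an n×n real symmetric positive semidefinite matrix, H a k×n real matrix, and R a k×k real symmetric positive definite matrix. Define the Kalman gain K = P_f Hᵀ (H P_f Hᵀ + R)⁻¹ and the analysis covariance P_a = (I − K H) P_f. Then P_a is positive semidefinite. -/
open Matrix

/-- The Joseph form of the covariance update: it agrees with `(1 - K * H) * P` whenever the gain `K`
satisfies `K * (H * P * Hᵀ + R) = P * Hᵀ`. -/
theorem joseph_form {m n α : Type*} [Fintype m] [Fintype n] [DecidableEq n] [CommRing α]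
    {P : Matrix n n α} {H : Matrix m n α} {R : Matrix m m α} {K : Matrix n m α}
    (hK : K * (H * P * Hᵀ + R) = P * Hᵀ) :
    (1 - K * H) * P * (1 - K * H)ᵀ + K * R * Kᵀ = (1 - K * H) * P := by
  have h : K * R = (1 - K * H) * P * Hᵀ := by
    rw [Matrix.sub_mul, Matrix.sub_mul, Matrix.one_mul, ← hK, Matrix.mul_add]
    simp only [Matrix.mul_assoc, add_sub_cancel_left]
  rw [h, transpose_sub, transpose_one, transpose_mul, Matrix.mul_sub, Matrix.mul_one,
    Matrix.mul_assoc _ Hᵀ Kᵀ, sub_add_cancel]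

/-- With `K = P_f Hᵀ (H P_f Hᵀ + R)⁻¹` and `P_a = (I - K H) P_f`,
the analysis covariance `P_a` is positive semidefinite. -/
theorem analysis_covariance_posSemidef
    {n k : ℕ} (Pf : Matrix (Fin n) (Fin n) ℝ) (H : Matrix (Fin k) (Fin n) ℝ)
    (R : Matrix (Fin k) (Fin k) ℝ)
    (hPf : Pf.PosSemidef) (hR : R.PosDef)
    (K : Matrix (Fin n) (Fin k) ℝ) (hK : K = Pf * Hᵀ * (H * Pf * Hᵀ + R)⁻¹)
    (Pa : Matrix (Fin n) (Fin n) ℝ) (hPa : Pa = (1 - K * H) * Pf) :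
    Pa.PosSemidef := by
  have hS : (H * Pf * Hᵀ + R).PosDef := by
    simpa only [conjTranspose_eq_transpose_of_trivial] using PosDef.posSemidef_add (hPf.mul_mul_conjTranspose_same H) hR
  have hKS : K * (H * Pf * Hᵀ + R) = Pf * Hᵀ := by
    rw [hK, nonsing_inv_mul_cancel_right _ _ hS.det_pos.ne'.isUnit]
  rw [hPa, ← joseph_form hKS]
  simpa only [conjTranspose_eq_transpose_of_trivial] using
    (hPf.mul_mul_conjTranspose_same (1 - K * H)).add
      (hR.posSemidef.mul_mul_conjTranspose_same K)
end

section
/- Let P_f be an n×n real symmetric positive semidefinite matrix, H a k×n real matrix, R a k×k real symmetric positive definite matrix, and set S = Hᵀ R⁻¹ H. Define P(s) = P_f (I + s S P_f)⁻¹ for s ≥ 0 (this inverse exists). Then P(0) = P_f and, for every s ≥ 0, the matrix-valued function P is differentiable at s with derivative P'(s) = −P(s) S P(s); i.e., P solves the matrix Riccati differential equation dP/ds = −P S P with initial condition P(0) = P_f. -/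
open Matrix

attribute [local instance] Matrix.normedAddCommGroup Matrix.normedSpace

/-- The derivative of the inverse of an affine path in a finite-dimensional normed algebra,
tested against a linear functional. -/
theorem hasDerivAt_linearMap_ringInverse_one_add_smul {E : Type*} [NormedRing E]
    [NormedAlgebra ℝ E] [FiniteDimensional ℝ E] (φ : E →ₗ[ℝ] ℝ) (a : E) (s : ℝ)
    (h : IsUnit (1 + s • a)) :
    HasDerivAt (fun t : ℝ => φ (Ring.inverse (1 + t • a)))
      (φ (-(Ring.inverse (1 + s • a) * a * Ring.inverse (1 + s • a)))) s := by
  have := FiniteDimensional.complete ℝ E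
  obtain ⟨u, hu⟩ := h
  have hpath : HasDerivAt (fun t : ℝ => 1 + t • a) a s := by
    simpa using ((hasDerivAt_id s).smul_const a).const_add 1
  have hinv := hasFDerivAt_ringInverse (𝕜 := ℝ) u
  rw [hu] at hinv
  have hφ := (LinearMap.toContinuousLinearMap φ).hasFDerivAt.comp_hasDerivAt s
    (hinv.comp_hasDerivAt s hpath)
  rw [← hu, Ring.inverse_unit]
  simpa [Function.comp_def] using hφ

/-- Entrywise derivative of the inverse of an affine path of matrices. -/
theorem hasDerivAt_inv_one_add_smul_apply {n : Type*} [Fintype n] [DecidableEq n]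
    (A : Matrix n n ℝ) (s : ℝ) (h : IsUnit (1 + s • A)) (i j : n) :
    HasDerivAt (fun t : ℝ => (1 + t • A)⁻¹ i j)
      ((-((1 + s • A)⁻¹ * A * (1 + s • A)⁻¹)) i j) s := by
  simp only [Matrix.nonsing_inv_eq_ringInverse]
  exact @hasDerivAt_linearMap_ringInverse_one_add_smul _ Matrix.linftyOpNormedRing
    Matrix.linftyOpNormedAlgebra inferInstance (Matrix.entryLinearMap ℝ ℝ i j) A s h

/-- `1 + A * B` is invertible for positive semidefinite real matrices `A` and `B`. -/
theorem Matrix.PosSemidef.isUnit_one_add_mul {n : Type*} [Fintype n] [DecidableEq n]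
    {A B : Matrix n n ℝ} (hA : A.PosSemidef) (hB : B.PosSemidef) : IsUnit (1 + A * B) := by
  obtain ⟨C, rfl⟩ : ∃ C : Matrix n n ℝ, B = Cᴴ * C := by
    open scoped MatrixOrder Matrix.Norms.L2Operator in
    exact CStarAlgebra.nonneg_iff_eq_star_mul_self.mp hB.nonneg
  rw [Matrix.isUnit_iff_isUnit_det, ← Matrix.mul_assoc, Matrix.det_one_add_mul_comm,
    ← Matrix.mul_assoc, ← Matrix.isUnit_iff_isUnit_det]
  exact (Matrix.PosDef.one.add_posSemidef (hA.mul_mul_conjTranspose_same C)).isUnit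

/-- With `S = Hᵀ R⁻¹ H`, the matrix-valued function
`P(s) = P_f (I + s S P_f)⁻¹` satisfies `P(0) = P_f` and solves the matrix
Riccati differential equation `dP/ds = -P S P` for all `s ≥ 0`. -/
theorem riccati_flow_solves_riccati_equation
    {n k : ℕ} (Pf : Matrix (Fin n) (Fin n) ℝ) (H : Matrix (Fin k) (Fin n) ℝ)
    (R : Matrix (Fin k) (Fin k) ℝ)
    (hPf : Pf.PosSemidef) (hR : R.PosDef)
    (S : Matrix (Fin n) (Fin n) ℝ) (hS : S = Hᵀ * R⁻¹ * H)
    (P : ℝ → Matrix (Fin n) (Fin n) ℝ)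
    (hP : ∀ s : ℝ, P s = Pf * (1 + s • (S * Pf))⁻¹) :
    P 0 = Pf ∧ ∀ s : ℝ, 0 ≤ s → HasDerivAt P (-(P s * S * P s)) s := by
  have hS_psd : S.PosSemidef := by
    rw [hS]
    simpa using hR.posSemidef.inv.conjTranspose_mul_mul_same H
  refine ⟨by simp [hP], fun s hs => ?_⟩
  have hunit : IsUnit (1 + s • (S * Pf)) := by
    simpa using (hS_psd.smul hs).isUnit_one_add_mul hPf
  have hderiv : -(P s * S * P s) =
      Pf * -((1 + s • (S * Pf))⁻¹ * (S * Pf) * (1 + s • (S * Pf))⁻¹) := by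
    simp only [hP, Matrix.mul_neg, Matrix.mul_assoc]
  rw [hderiv, funext hP]
  refine hasDerivAt_pi.mpr fun i => hasDerivAt_pi.mpr fun j => ?_
  simp only [Matrix.mul_apply (M := Pf)]
  exact HasDerivAt.fun_sum fun l _ =>
    (hasDerivAt_inv_one_add_smul_apply (S * Pf) s hunit l j).const_mul (Pf i l)
end

section
/- Let P_f be an n×n real symmetric positive semidefinite matrix, H a k×n real matrix, R a k×k real symmetric positive definite matrix, and set S = Hᵀ R⁻¹ H. Define the Kalman gain K = P_f Hᵀ (H P_f Hᵀ + R)⁻¹. Then P_f (I + S P_f)⁻¹ = (I − K H) P_f; i.e., the solution of the Riccati flow P(s) = P_f (I + s S P_f)⁻¹ evaluated at fictitious time s = 1 equals the Kalman analysis covariance. -/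
open Matrix

/-- A Woodbury-type right inverse of `1 + U R⁻¹ V`. -/
theorem one_add_mul_inv_mul_mul_one_sub {m n α : Type*} [Fintype m] [DecidableEq m] [Fintype n]
    [DecidableEq n] [CommRing α] (U : Matrix n m α) (V : Matrix m n α) (R : Matrix m m α)
    (hR : IsUnit R.det) (hM : IsUnit (V * U + R).det) :
    (1 + U * R⁻¹ * V) * (1 - U * (V * U + R)⁻¹ * V) = 1 := by
  have key : R⁻¹ - (V * U + R)⁻¹ - R⁻¹ * (V * U) * (V * U + R)⁻¹ = 0 := by
    have h : R⁻¹ * (V * U + R) * (V * U + R)⁻¹ = R⁻¹ := mul_nonsing_inv_cancel_right _ _ hM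
    rw [Matrix.mul_add, nonsing_inv_mul R hR, Matrix.add_mul, Matrix.one_mul] at h
    rw [sub_sub, add_comm, h, sub_self]
  calc (1 + U * R⁻¹ * V) * (1 - U * (V * U + R)⁻¹ * V)
      = 1 + U * (R⁻¹ - (V * U + R)⁻¹ - R⁻¹ * (V * U) * (V * U + R)⁻¹) * V := by
        simp only [Matrix.add_mul, Matrix.mul_sub, Matrix.sub_mul, Matrix.one_mul,
          Matrix.mul_one, Matrix.mul_assoc]
        abel
    _ = 1 := by rw [key, Matrix.mul_zero, Matrix.zero_mul, add_zero]

/-- With `S = Hᵀ R⁻¹ H` and Kalman gain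
`K = P_f Hᵀ (H P_f Hᵀ + R)⁻¹`, the Riccati flow `P(s) = P_f (I + s S P_f)⁻¹`
at fictitious time `s = 1` equals the Kalman analysis covariance:
`P_f (I + S P_f)⁻¹ = (I - K H) P_f`. -/
theorem riccati_flow_at_one_eq_kalman_analysis
    {n k : ℕ} (Pf : Matrix (Fin n) (Fin n) ℝ) (H : Matrix (Fin k) (Fin n) ℝ)
    (R : Matrix (Fin k) (Fin k) ℝ)
    (hPf : Pf.PosSemidef) (hR : R.PosDef)
    (S : Matrix (Fin n) (Fin n) ℝ) (hS : S = Hᵀ * R⁻¹ * H)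
    (K : Matrix (Fin n) (Fin k) ℝ) (hK : K = Pf * Hᵀ * (H * Pf * Hᵀ + R)⁻¹) :
    Pf * (1 + S * Pf)⁻¹ = (1 - K * H) * Pf := by
  have hM : (H * Pf * Hᵀ + R).PosDef := by
    have h := hPf.mul_mul_conjTranspose_same H
    rw [conjTranspose_eq_transpose_of_trivial] at h
    exact PosDef.posSemidef_add h hR
  have hinv := one_add_mul_inv_mul_mul_one_sub Hᵀ (H * Pf) R
    ((isUnit_iff_isUnit_det _).mp hR.isUnit) ((isUnit_iff_isUnit_det _).mp hM.isUnit)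
  rw [← Matrix.mul_assoc, ← hS] at hinv
  rw [inv_eq_right_inv hinv, hK]
  simp only [Matrix.mul_sub, Matrix.sub_mul, Matrix.one_mul, Matrix.mul_one, Matrix.mul_assoc]
end

section
/- Let H be a k×n real matrix, R a k×k real symmetric positive definite matrix, S = Hᵀ R⁻¹ H, and m ≥ 2 a natural number. Suppose Y : ℝ → ℝ^{n×m} is differentiable and satisfies the matrix differential equation dY/ds = −(1/(2(m−1))) Y Yᵀ S Y for all s in an interval. Then the matrix-valued function P(s) = (1/(m−1)) Y(s) Y(s)ᵀ is differentiable on that interval and satisfies the Riccati equation dP/ds = −P(s) S P(s). -/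
open Matrix

attribute [local instance] Matrix.normedAddCommGroup Matrix.normedSpace

theorem Matrix.hasDerivAt_iff {p q : ℕ} {A : ℝ → Matrix (Fin p) (Fin q) ℝ}
    {A' : Matrix (Fin p) (Fin q) ℝ} {s : ℝ} :
    HasDerivAt A A' s ↔ ∀ i j, HasDerivAt (fun t => A t i j) (A' i j) s :=
  hasDerivAt_pi.trans (forall_congr' fun _ => hasDerivAt_pi)

theorem Matrix.hasDerivAt_mul_transpose {p q : ℕ} {A : ℝ → Matrix (Fin p) (Fin q) ℝ}
    {A' : Matrix (Fin p) (Fin q) ℝ} {s : ℝ} (hA : HasDerivAt A A' s) :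
    HasDerivAt (fun t => A t * (A t)ᵀ) (A' * (A s)ᵀ + A s * A'ᵀ) s := by
  rw [Matrix.hasDerivAt_iff] at hA ⊢
  intro i j
  simp only [Matrix.add_apply, Matrix.mul_apply, Matrix.transpose_apply,
    ← Finset.sum_add_distrib]
  exact HasDerivAt.fun_sum fun l _ => (hA i l).mul (hA j l)

/-- If the ensemble deviation matrix `Y(s)` satisfies the
matrix ODE `dY/ds = -(1/(2(m-1))) Y Yᵀ S Y` on an interval (a, b), with
`S = Hᵀ R⁻¹ H`, then the empirical covariance `P(s) = (1/(m-1)) Y(s) Y(s)ᵀ`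
satisfies the Riccati equation `dP/ds = -P S P` on that interval. -/
theorem deviation_ode_gives_riccati
    {n k : ℕ} (H : Matrix (Fin k) (Fin n) ℝ) (R : Matrix (Fin k) (Fin k) ℝ)
    (hR : R.PosDef)
    (S : Matrix (Fin n) (Fin n) ℝ) (hS : S = Hᵀ * R⁻¹ * H)
    (m : ℕ) (hm : 2 ≤ m)
    (a b : ℝ)
    (Y : ℝ → Matrix (Fin n) (Fin m) ℝ)
    (hY : ∀ s ∈ Set.Ioo a b,
      HasDerivAt Y (-(1 / (2 * ((m : ℝ) - 1))) • (Y s * (Y s)ᵀ * S * Y s)) s)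
    (P : ℝ → Matrix (Fin n) (Fin n) ℝ)
    (hP : ∀ s : ℝ, P s = (1 / ((m : ℝ) - 1)) • (Y s * (Y s)ᵀ)) :
    ∀ s ∈ Set.Ioo a b, HasDerivAt P (-(P s * S * P s)) s := by
  intro s hs
  have hm' : (m : ℝ) - 1 ≠ 0 := by
    have : (2 : ℝ) ≤ m := by exact_mod_cast hm
    linarith
  have hRt : Rᵀ = R := by simpa using hR.isHermitian.eq
  have hSt : Sᵀ = S := by
    rw [hS]
    simp [Matrix.transpose_nonsing_inv, hRt, Matrix.mul_assoc]
  have hval : -(P s * S * P s) = (1 / ((m : ℝ) - 1)) •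
      (-(1 / (2 * ((m : ℝ) - 1))) • (Y s * (Y s)ᵀ * S * Y s) * (Y s)ᵀ +
        Y s * (-(1 / (2 * ((m : ℝ) - 1))) • (Y s * (Y s)ᵀ * S * Y s))ᵀ) := by
    simp only [hP, Matrix.transpose_smul, Matrix.transpose_mul, Matrix.transpose_transpose, hSt,
      Matrix.smul_mul, Matrix.mul_smul, Matrix.mul_assoc, smul_smul, ← add_smul, ← neg_smul]
    congr 1
    field_simp
    ring
  rw [hval, show P = fun t => (1 / ((m : ℝ) - 1)) • (Y t * (Y t)ᵀ) from funext hP]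
  exact (Matrix.hasDerivAt_mul_transpose (hY s hs)).const_smul (1 / ((m : ℝ) - 1))
end

section
/- Let H be a k×n real matrix, R a k×k real symmetric positive definite matrix, S = Hᵀ R⁻¹ H, and m ≥ 2 a natural number. Suppose Y : [0,1] → ℝ^{n×m} is differentiable and satisfies dY/ds = −(1/(2(m−1))) Y Yᵀ S Y on [0,1], with initial condition such that P_f := (1/(m−1)) Y(0) Y(0)ᵀ. Define the Kalman gain K = P_f Hᵀ (H P_f Hᵀ + R)⁻¹. Then (1/(m−1)) Y(1) Y(1)ᵀ = (I − K H) P_f; i.e., the ensemble deviation ODE solved over a unit fictitious-time interval reproduces the Kalman analysis covariance exactly. -/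
open Matrix

attribute [local instance] Matrix.normedAddCommGroup Matrix.normedSpace

theorem Matrix.hasDerivAt_iff_entry {a b : ℕ} {A : ℝ → Matrix (Fin a) (Fin b) ℝ}
    {A' : Matrix (Fin a) (Fin b) ℝ} {s : ℝ} :
    HasDerivAt A A' s ↔ ∀ i j, HasDerivAt (fun t => A t i j) (A' i j) s := by
  refine Iff.trans (hasDerivAt_pi (φ := A)) ?_
  exact forall_congr' fun i => hasDerivAt_pi

theorem HasDerivAt.matrix_mul_fin {a b c : ℕ} {A : ℝ → Matrix (Fin a) (Fin b) ℝ}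
    {B : ℝ → Matrix (Fin b) (Fin c) ℝ} {A' : Matrix (Fin a) (Fin b) ℝ}
    {B' : Matrix (Fin b) (Fin c) ℝ} {s : ℝ} (hA : HasDerivAt A A' s) (hB : HasDerivAt B B' s) :
    HasDerivAt (fun t => A t * B t) (A' * B s + A s * B') s := by
  rw [Matrix.hasDerivAt_iff_entry] at *
  intro i j
  simp only [Matrix.mul_apply, Matrix.add_apply, ← Finset.sum_add_distrib]
  exact HasDerivAt.fun_sum fun l _ => (hA i l).mul (hB l j)

theorem HasDerivAt.matrix_transpose_fin {a b : ℕ} {A : ℝ → Matrix (Fin a) (Fin b) ℝ}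
    {A' : Matrix (Fin a) (Fin b) ℝ} {s : ℝ} (hA : HasDerivAt A A' s) :
    HasDerivAt (fun t => (A t)ᵀ) A'ᵀ s := by
  rw [Matrix.hasDerivAt_iff_entry] at *
  exact fun i j => hA j i

theorem Matrix.norm_mul_le_card_mul {a b c : ℕ} (A : Matrix (Fin a) (Fin b) ℝ)
    (B : Matrix (Fin b) (Fin c) ℝ) : ‖A * B‖ ≤ b * ‖B‖ * ‖A‖ := by
  rw [Matrix.norm_le_iff (by positivity)]
  intro i j
  calc ‖(A * B) i j‖ ≤ ∑ l, ‖A i l * B l j‖ := by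
        rw [Matrix.mul_apply]; exact norm_sum_le _ _
    _ ≤ ∑ _l : Fin b, ‖A‖ * ‖B‖ := by
        refine Finset.sum_le_sum fun l _ => ?_
        rw [norm_mul]
        gcongr <;> exact Matrix.norm_entry_le_entrywise_sup_norm _
    _ = b * ‖B‖ * ‖A‖ := by simp; ring

/-- A solution on `[0, 1]` of the linear equation `D' = D A` that vanishes at `0` vanishes. -/
theorem Matrix.eq_zero_of_hasDerivAt_mul {a b : ℕ} {D : ℝ → Matrix (Fin a) (Fin b) ℝ}
    {A : ℝ → Matrix (Fin b) (Fin b) ℝ} (hA : ContinuousOn A (Set.Icc 0 1))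
    (hD : ∀ s ∈ Set.Icc (0 : ℝ) 1, HasDerivAt D (D s * A s) s) (h0 : D 0 = 0) :
    ∀ s ∈ Set.Icc (0 : ℝ) 1, D s = 0 := by
  obtain ⟨C, hC⟩ := isCompact_Icc.exists_bound_of_continuousOn hA
  refine eq_zero_of_abs_deriv_le_mul_abs_self_of_eq_zero_right (K := b * C)
    (fun s hs => (hD s hs).continuousAt.continuousWithinAt)
    (fun s hs => (hD s (Set.Ico_subset_Icc_self hs)).hasDerivWithinAt) h0 fun s hs => ?_
  refine (Matrix.norm_mul_le_card_mul _ _).trans ?_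
  gcongr
  exact hC s (Set.Ico_subset_Icc_self hs)

/-- Along the Riccati flow `P' = -P S P`, one has `(1 + s P(0) S) P(s) = P(0)`. -/
theorem Matrix.riccati_flow_eq {n : ℕ} {S : Matrix (Fin n) (Fin n) ℝ}
    {P : ℝ → Matrix (Fin n) (Fin n) ℝ}
    (hP : ∀ s ∈ Set.Icc (0 : ℝ) 1, HasDerivAt P (-(P s * S * P s)) s) :
    ∀ s ∈ Set.Icc (0 : ℝ) 1, (1 + s • (P 0 * S)) * P s = P 0 := by
  intro s hs
  refine sub_eq_zero.mp (Matrix.eq_zero_of_hasDerivAt_mul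
    (D := fun t => (1 + t • (P 0 * S)) * P t - P 0) (A := fun t => -(S * P t)) ?_ ?_ ?_ s hs)
  · exact fun t ht => (((hasDerivAt_const t S).matrix_mul_fin
      (hP t ht)).neg).continuousAt.continuousWithinAt
  · intro t ht
    have h1 : HasDerivAt (fun t : ℝ => 1 + t • (P 0 * S)) (P 0 * S) t := by
      refine HasDerivAt.const_add 1 ?_
      simpa using (hasDerivAt_id t).smul_const (P 0 * S)
    refine ((h1.matrix_mul_fin (hP t ht)).sub_const (P 0)).congr_deriv ?_
    simp only [Matrix.sub_mul, Matrix.mul_neg, Matrix.mul_assoc]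
    abel
  · simp

/-- With gain `K = P Hᵀ (H P Hᵀ + R)⁻¹`, `1 - K H` is a left inverse of `1 + P Hᵀ R⁻¹ H`. -/
theorem Matrix.one_sub_gain_mul {n k : ℕ} {H : Matrix (Fin k) (Fin n) ℝ}
    {R : Matrix (Fin k) (Fin k) ℝ} {P : Matrix (Fin n) (Fin n) ℝ}
    (hR : IsUnit R.det) (hM : IsUnit (H * P * Hᵀ + R).det) :
    (1 - P * Hᵀ * (H * P * Hᵀ + R)⁻¹ * H) * (1 + P * (Hᵀ * R⁻¹ * H)) = 1 := by
  have key : P * Hᵀ * (H * P * Hᵀ + R)⁻¹ * H * (1 + P * (Hᵀ * R⁻¹ * H)) =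
      P * (Hᵀ * R⁻¹ * H) := by
    have h1 : H * (1 + P * (Hᵀ * R⁻¹ * H)) = (H * P * Hᵀ + R) * (R⁻¹ * H) := by
      rw [Matrix.add_mul, Matrix.mul_nonsing_inv_cancel_left _ _ hR]
      simp only [Matrix.mul_add, Matrix.mul_one, Matrix.mul_assoc, add_comm]
    rw [Matrix.mul_assoc _ H, h1, Matrix.mul_assoc _ _ (_ * (R⁻¹ * H)),
      Matrix.nonsing_inv_mul_cancel_left _ _ hM]
    simp only [Matrix.mul_assoc]
  rw [Matrix.sub_mul, key, Matrix.one_mul, add_sub_cancel_right]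

/-- If the ensemble deviation matrix `Y(s)` satisfies
`dY/ds = -(1/(2(m-1))) Y Yᵀ S Y` on [0,1] with `S = Hᵀ R⁻¹ H`, and
`P_f = (1/(m-1)) Y(0) Y(0)ᵀ`, `K = P_f Hᵀ (H P_f Hᵀ + R)⁻¹`, then
`(1/(m-1)) Y(1) Y(1)ᵀ = (I - K H) P_f`: the deviation ODE over a unit
fictitious-time interval reproduces the Kalman analysis covariance. -/
theorem deviation_ode_reproduces_kalman_covariance
    {n k : ℕ} (H : Matrix (Fin k) (Fin n) ℝ) (R : Matrix (Fin k) (Fin k) ℝ)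
    (hR : R.PosDef)
    (S : Matrix (Fin n) (Fin n) ℝ) (hS : S = Hᵀ * R⁻¹ * H)
    (m : ℕ) (hm : 2 ≤ m)
    (Y : ℝ → Matrix (Fin n) (Fin m) ℝ)
    (hY : ∀ s ∈ Set.Icc (0 : ℝ) 1,
      HasDerivAt Y (-(1 / (2 * ((m : ℝ) - 1))) • (Y s * (Y s)ᵀ * S * Y s)) s)
    (Pf : Matrix (Fin n) (Fin n) ℝ)
    (hPf : Pf = (1 / ((m : ℝ) - 1)) • (Y 0 * (Y 0)ᵀ))
    (K : Matrix (Fin n) (Fin k) ℝ) (hK : K = Pf * Hᵀ * (H * Pf * Hᵀ + R)⁻¹) :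
    (1 / ((m : ℝ) - 1)) • (Y 1 * (Y 1)ᵀ) = (1 - K * H) * Pf := by
  have hc : (0 : ℝ) ≤ 1 / ((m : ℝ) - 1) := by
    have : (2 : ℝ) ≤ m := by exact_mod_cast hm
    exact one_div_nonneg.mpr (by linarith)
  have hSt : Sᵀ = S := by
    have hRt : Rᵀ = R := hR.isHermitian
    rw [hS]
    simp [Matrix.transpose_mul, Matrix.transpose_nonsing_inv, hRt, Matrix.mul_assoc]
  have hP : ∀ s ∈ Set.Icc (0 : ℝ) 1,
      HasDerivAt (fun t => (1 / ((m : ℝ) - 1)) • (Y t * (Y t)ᵀ))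
        (-((1 / ((m : ℝ) - 1)) • (Y s * (Y s)ᵀ) * S * (1 / ((m : ℝ) - 1)) • (Y s * (Y s)ᵀ))) s := by
    intro s hs
    have h := ((hY s hs).matrix_mul_fin (hY s hs).matrix_transpose_fin).const_smul
      (1 / ((m : ℝ) - 1))
    refine h.congr_deriv ?_
    have hhalf : 1 / (2 * ((m : ℝ) - 1)) = (1 / ((m : ℝ) - 1)) / 2 := by
      rw [mul_comm, div_mul_eq_div_div]
    rw [hhalf]
    simp only [Matrix.transpose_smul, Matrix.transpose_mul, Matrix.transpose_transpose, hSt,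
      Matrix.smul_mul, Matrix.mul_smul, Matrix.mul_assoc]
    module
  have hflow := Matrix.riccati_flow_eq hP 1 (by simp)
  simp only [one_smul, ← hPf] at hflow
  have hPpos : Pf.PosSemidef := by
    rw [hPf]
    exact (Matrix.posSemidef_self_mul_conjTranspose (Y 0)).smul hc
  have hM : (H * Pf * Hᵀ + R).PosDef :=
    Matrix.PosDef.posSemidef_add (hPpos.mul_mul_conjTranspose_same H) hR
  have hinv := Matrix.one_sub_gain_mul hR.det_pos.ne'.isUnit hM.det_pos.ne'.isUnit
  rw [← hS, ← hK] at hinv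
  conv_rhs => rw [← hflow, ← Matrix.mul_assoc, hinv, Matrix.one_mul]
end

section
/- Let P_f be an n×n real symmetric positive semidefinite matrix, H a k×n real matrix, R a k×k real symmetric positive definite matrix, S = Hᵀ R⁻¹ H, and y ∈ ℝ^k. Define P(s) = P_f (I + s S P_f)⁻¹ for s ∈ [0,1] and the Kalman gain K = P_f Hᵀ (H P_f Hᵀ + R)⁻¹. Suppose x̄ : [0,1] → ℝⁿ is differentiable and satisfies dx̄/ds = −P(s) Hᵀ R⁻¹ (H x̄(s) − y) on [0,1] with x̄(0) = x̄_f. Then x̄(1) = x̄_f − K (H x̄_f − y); i.e., the continuous mean ODE solved over a unit fictitious-time interval reproduces the Kalman analysis update of the mean. -/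
open Matrix

/-- Push-through form of `det (1 + A R⁻¹ B)`: the information matrix added to the identity is
invertible along the whole flow. -/
theorem isUnit_det_one_add_smul_information_mul
    {n k : Type*} [Fintype n] [DecidableEq n] [Fintype k] [DecidableEq k]
    {Pf : Matrix n n ℝ} (H : Matrix k n ℝ) {R : Matrix k k ℝ}
    (hPf : Pf.PosSemidef) (hR : R.PosDef) {s : ℝ} (hs : 0 ≤ s) :
    IsUnit (1 + s • (Hᵀ * R⁻¹ * H * Pf)).det := by
  have hpos : (R + s • (H * Pf * Hᵀ)).PosDef := by
    refine hR.add_posSemidef (PosSemidef.smul ?_ hs)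
    simpa [conjTranspose_eq_transpose_of_trivial] using hPf.mul_mul_conjTranspose_same H
  have hRu : IsUnit R.det := (isUnit_iff_isUnit_det R).1 hR.isUnit
  have hfac : 1 + R⁻¹ * H * Pf * (s • Hᵀ) = R⁻¹ * (R + s • (H * Pf * Hᵀ)) := by
    rw [mul_add, nonsing_inv_mul R hRu]
    simp only [Matrix.mul_smul, Matrix.mul_assoc]
  have hcomm : (1 + s • (Hᵀ * R⁻¹ * H * Pf)).det = (R⁻¹ * (R + s • (H * Pf * Hᵀ))).det := by
    rw [← hfac, ← det_one_add_mul_comm]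
    simp only [Matrix.smul_mul, Matrix.mul_assoc]
  rw [hcomm, det_mul]
  exact (isUnit_nonsing_inv_det R hRu).mul ((isUnit_iff_isUnit_det _).1 hpos.isUnit)

/-- The Kalman gain satisfies `(1 + P_f Hᵀ R⁻¹ H) K = P_f Hᵀ R⁻¹`. -/
theorem one_add_mul_kalman_gain
    {n k : Type*} [Fintype n] [DecidableEq n] [Fintype k] [DecidableEq k]
    {Pf : Matrix n n ℝ} (H : Matrix k n ℝ) {R : Matrix k k ℝ}
    (hPf : Pf.PosSemidef) (hR : R.PosDef) :
    (1 + Pf * (Hᵀ * R⁻¹ * H)) * (Pf * Hᵀ * (H * Pf * Hᵀ + R)⁻¹) = Pf * Hᵀ * R⁻¹ := by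
  have hpos : (H * Pf * Hᵀ + R).PosDef := by
    refine PosDef.posSemidef_add ?_ hR
    simpa [conjTranspose_eq_transpose_of_trivial] using hPf.mul_mul_conjTranspose_same H
  have hRu : IsUnit R.det := (isUnit_iff_isUnit_det R).1 hR.isUnit
  have hfac : (1 + Pf * (Hᵀ * R⁻¹ * H)) * (Pf * Hᵀ) = Pf * Hᵀ * R⁻¹ * (H * Pf * Hᵀ + R) := by
    rw [Matrix.mul_add, nonsing_inv_mul_cancel_right R _ hRu, Matrix.add_mul, Matrix.one_mul, add_comm]
    simp only [Matrix.mul_assoc]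
  rw [← Matrix.mul_assoc, hfac,
    mul_nonsing_inv_cancel_right _ _ ((isUnit_iff_isUnit_det _).1 hpos.isUnit)]

/-- A trajectory whose velocity satisfies `(1 + s M) x' = b - M x` conserves
`x + s (M x - b)`. -/
theorem add_mulVec_eq_of_hasDerivAt {n : Type*} [Fintype n] [DecidableEq n]
    {M : Matrix n n ℝ} {b : n → ℝ} {x x' : ℝ → n → ℝ}
    (hx : ∀ s ∈ Set.Icc (0 : ℝ) 1, HasDerivAt x (x' s) s)
    (hx' : ∀ s ∈ Set.Icc (0 : ℝ) 1, (1 + s • M) *ᵥ x' s = b - M *ᵥ x s) :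
    (1 + M) *ᵥ x 1 = x 0 + b := by
  have hderiv : ∀ s ∈ Set.Icc (0 : ℝ) 1,
      HasDerivAt (fun t => x t + t • (M *ᵥ x t - b)) 0 s := by
    intro s hs
    have hM : HasDerivAt (fun t => M *ᵥ x t) (M *ᵥ x' s) s :=
      (LinearMap.toContinuousLinearMap M.mulVecLin).hasFDerivAt.comp_hasDerivAt s (hx s hs)
    have hzero : x' s + (s • (M *ᵥ x' s) + (1 : ℝ) • (M *ᵥ x s - b)) = 0 := by
      have h := hx' s hs
      rw [add_mulVec, one_mulVec, smul_mulVec] at h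
      rw [one_smul, ← add_assoc, h]
      abel
    rw [← hzero]
    exact (hx s hs).add ((hasDerivAt_id s).smul (hM.sub_const b))
  have h := constant_of_has_deriv_right_zero
    (fun s hs => (hderiv s hs).continuousAt.continuousWithinAt)
    (fun s hs => (hderiv s (Set.Ico_subset_Icc_self hs)).hasDerivWithinAt) 1 (by simp)
  simp only [one_smul, zero_smul, add_zero] at h
  rw [add_mulVec, one_mulVec, ← h]
  abel

/-- Along the covariance flow `P(s) = P_f (I + s S P_f)⁻¹`,
if the mean `x̄(s)` satisfies `dx̄/ds = -P(s) Hᵀ R⁻¹ (H x̄(s) - y)` on [0,1]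
with `x̄(0) = x̄_f`, then `x̄(1) = x̄_f - K (H x̄_f - y)` with Kalman gain
`K = P_f Hᵀ (H P_f Hᵀ + R)⁻¹`. -/
theorem mean_ode_reproduces_kalman_mean_update
    {n k : ℕ} (Pf : Matrix (Fin n) (Fin n) ℝ) (H : Matrix (Fin k) (Fin n) ℝ)
    (R : Matrix (Fin k) (Fin k) ℝ) (y : Fin k → ℝ)
    (hPf : Pf.PosSemidef) (hR : R.PosDef)
    (S : Matrix (Fin n) (Fin n) ℝ) (hS : S = Hᵀ * R⁻¹ * H)
    (P : ℝ → Matrix (Fin n) (Fin n) ℝ)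
    (hP : ∀ s : ℝ, P s = Pf * (1 + s • (S * Pf))⁻¹)
    (K : Matrix (Fin n) (Fin k) ℝ) (hK : K = Pf * Hᵀ * (H * Pf * Hᵀ + R)⁻¹)
    (xbar : ℝ → Fin n → ℝ) (xf : Fin n → ℝ) (h0 : xbar 0 = xf)
    (hode : ∀ s ∈ Set.Icc (0 : ℝ) 1,
      HasDerivAt xbar (-((P s * Hᵀ * R⁻¹).mulVec (H.mulVec (xbar s) - y))) s) :
    xbar 1 = xf - K.mulVec (H.mulVec xf - y) := by
  subst hS hK h0
  have hflow : (1 + Pf * (Hᵀ * R⁻¹ * H)) *ᵥ xbar 1 = xbar 0 + (Pf * Hᵀ * R⁻¹) *ᵥ y := by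
    refine add_mulVec_eq_of_hasDerivAt hode fun s hs => ?_
    have hP' : (1 + s • (Pf * (Hᵀ * R⁻¹ * H))) * P s = Pf := by
      have hcomm : (1 + s • (Pf * (Hᵀ * R⁻¹ * H))) * Pf
          = Pf * (1 + s • (Hᵀ * R⁻¹ * H * Pf)) := by
        simp only [add_mul, mul_add, one_mul, mul_one, Matrix.smul_mul, Matrix.mul_smul,
          Matrix.mul_assoc]
      rw [hP, ← Matrix.mul_assoc, hcomm, mul_nonsing_inv_cancel_right _ _
        (isUnit_det_one_add_smul_information_mul H hPf hR hs.1)]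
    rw [mulVec_neg, mulVec_mulVec, ← Matrix.mul_assoc, ← Matrix.mul_assoc, hP', mulVec_sub,
      mulVec_mulVec, neg_sub]
    simp only [Matrix.mul_assoc]
  have hunit : IsUnit (1 + Pf * (Hᵀ * R⁻¹ * H)) := by
    rw [isUnit_iff_isUnit_det, det_one_add_mul_comm]
    simpa using isUnit_det_one_add_smul_information_mul H hPf hR zero_le_one
  apply mulVec_injective_of_isUnit hunit
  rw [hflow, mulVec_sub, mulVec_mulVec, one_add_mul_kalman_gain H hPf hR, mulVec_sub,
    mulVec_mulVec, add_mulVec, one_mulVec]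
  simp only [Matrix.mul_assoc]
  abel
end

section
/- Let H be a k×n real matrix, R a k×k real symmetric positive definite matrix, y ∈ ℝ^k, and define the cost function S(x) = (1/2)(H x − y)ᵀ R⁻¹ (H x − y) for x ∈ ℝⁿ. For an ensemble x₁,…,x_m ∈ ℝⁿ with mean x̄ = (1/m) Σᵢ xᵢ, define the potential V(x₁,…,x_m) = (m/2) S(x̄) + (1/2) Σⱼ S(xⱼ). Then V is differentiable and, for each i, the gradient of V with respect to the ensemble member xᵢ (holding the other members fixed) equals (1/2)[ Hᵀ R⁻¹ (H xᵢ − y) + Hᵀ R⁻¹ (H x̄ − y) ]; i.e., the ensemble differential equations dxᵢ/ds = −(1/2) P { ∇S(xᵢ) + ∇S(x̄) } form the gradient system dxᵢ/ds = −P ∇_{xᵢ} V. -/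
open Matrix

/-- The weighted least-squares functional `x ↦ ½ (Hx - y)ᵀ A (Hx - y)` is differentiable. -/
theorem differentiable_half_mulVec_sub_dotProduct {n k : ℕ} (H : Matrix (Fin k) (Fin n) ℝ)
    (A : Matrix (Fin k) (Fin k) ℝ) (y : Fin k → ℝ) :
    Differentiable ℝ (fun x : Fin n → ℝ =>
      (1 / 2 : ℝ) * ((H *ᵥ x - y) ⬝ᵥ A *ᵥ (H *ᵥ x - y))) := by
  simp only [dotProduct, mulVec, Pi.sub_apply]
  fun_prop

/-- For symmetric `A`, the gradient of `x ↦ ½ (Hx - y)ᵀ A (Hx - y)` is `Hᵀ A (Hx - y)`. -/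
theorem fderiv_half_mulVec_sub_dotProduct {n k : ℕ} (H : Matrix (Fin k) (Fin n) ℝ)
    (A : Matrix (Fin k) (Fin k) ℝ) (hA : A.IsSymm) (y : Fin k → ℝ) (x u : Fin n → ℝ) :
    fderiv ℝ (fun x : Fin n → ℝ => (1 / 2 : ℝ) * ((H *ᵥ x - y) ⬝ᵥ A *ᵥ (H *ᵥ x - y))) x u =
      ((Hᵀ * A) *ᵥ (H *ᵥ x - y)) ⬝ᵥ u := by
  set f : (Fin n → ℝ) → ℝ := fun x => (1 / 2 : ℝ) * ((H *ᵥ x - y) ⬝ᵥ A *ᵥ (H *ᵥ x - y)) with hf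
  have hsymm : ∀ a b : Fin k → ℝ, a ⬝ᵥ A *ᵥ b = (A *ᵥ a) ⬝ᵥ b := fun a b => by
    rw [dotProduct_mulVec, ← mulVec_transpose, hA.eq]
  have hgrad : ((Hᵀ * A) *ᵥ (H *ᵥ x - y)) ⬝ᵥ u = (A *ᵥ (H *ᵥ x - y)) ⬝ᵥ (H *ᵥ u) := by
    rw [dotProduct_mulVec, ← mulVec_transpose, mulVec_mulVec]
  have hexp : ∀ t : ℝ, f (x + t • u) =
      f x + t * ((A *ᵥ (H *ᵥ x - y)) ⬝ᵥ (H *ᵥ u)) +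
        t ^ 2 * ((1 / 2 : ℝ) * ((H *ᵥ u) ⬝ᵥ A *ᵥ (H *ᵥ u))) := fun t => by
    have hsplit : H *ᵥ (x + t • u) - y = (H *ᵥ x - y) + t • (H *ᵥ u) := by
      rw [mulVec_add, mulVec_smul]; abel
    simp only [hf, hsplit]
    generalize H *ᵥ x - y = r
    generalize H *ᵥ u = w
    have hwr : w ⬝ᵥ A *ᵥ r = (A *ᵥ r) ⬝ᵥ w := dotProduct_comm _ _
    simp only [mulVec_add, mulVec_smul, dotProduct_add, add_dotProduct, smul_dotProduct,
      dotProduct_smul, smul_eq_mul, hwr, hsymm r w]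
    ring
  have hline : HasLineDerivAt ℝ f ((A *ᵥ (H *ᵥ x - y)) ⬝ᵥ (H *ᵥ u)) x u := by
    unfold HasLineDerivAt
    simp only [hexp]
    have hlin := (hasDerivAt_id (0 : ℝ)).mul_const ((A *ᵥ (H *ᵥ x - y)) ⬝ᵥ (H *ᵥ u))
    have hquad := ((hasDerivAt_id (0 : ℝ)).pow 2).mul_const
      ((1 / 2 : ℝ) * ((H *ᵥ u) ⬝ᵥ A *ᵥ (H *ᵥ u)))
    exact ((hlin.const_add (f x)).add hquad).congr_deriv (by simp)
  have hdiff : DifferentiableAt ℝ f x := differentiable_half_mulVec_sub_dotProduct H A y x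
  rw [hgrad, ← hdiff.lineDeriv_eq_fderiv, hline.lineDeriv]

/-- For the observation cost
`S(x) = (1/2)(Hx - y)ᵀ R⁻¹ (Hx - y)` and the potential
`V(x₁,…,x_m) = (m/2) S(x̄) + (1/2) Σⱼ S(xⱼ)` (with `x̄` the ensemble mean),
the potential is differentiable and its gradient with respect to the ensemble
member `xᵢ` equals `(1/2)[Hᵀ R⁻¹ (H xᵢ - y) + Hᵀ R⁻¹ (H x̄ - y)]`. -/
theorem potential_gradient_wrt_ensemble_member
    {n k : ℕ} (H : Matrix (Fin k) (Fin n) ℝ) (R : Matrix (Fin k) (Fin k) ℝ)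
    (y : Fin k → ℝ) (hR : R.PosDef)
    (m : ℕ) (hm : 1 ≤ m)
    (Scost : (Fin n → ℝ) → ℝ)
    (hScost : ∀ x, Scost x =
      (1 / 2) * ((H.mulVec x - y) ⬝ᵥ R⁻¹.mulVec (H.mulVec x - y)))
    (V : (Fin m → Fin n → ℝ) → ℝ)
    (hV : ∀ x : Fin m → Fin n → ℝ,
      V x = ((m : ℝ) / 2) * Scost ((1 / (m : ℝ)) • ∑ j, x j)
        + (1 / 2) * ∑ j, Scost (x j)) :
    Differentiable ℝ V ∧
      ∀ (x : Fin m → Fin n → ℝ) (i : Fin m) (u : Fin n → ℝ),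
        fderiv ℝ (fun v => V (Function.update x i v)) (x i) u =
          ((1 / 2 : ℝ) •
            ((Hᵀ * R⁻¹).mulVec (H.mulVec (x i) - y) +
             (Hᵀ * R⁻¹).mulVec (H.mulVec ((1 / (m : ℝ)) • ∑ j, x j) - y))) ⬝ᵥ u := by
  have hA : R⁻¹.IsSymm := by
    simpa [IsHermitian, IsSymm, conjTranspose_eq_transpose_of_trivial] using hR.inv.isHermitian
  obtain rfl : Scost = _ := funext hScost
  set S : (Fin n → ℝ) → ℝ := fun x => (1 / 2) * ((H *ᵥ x - y) ⬝ᵥ R⁻¹ *ᵥ (H *ᵥ x - y))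
  have hS : ∀ x, HasFDerivAt S (fderiv ℝ S x) x := fun x =>
    (differentiable_half_mulVec_sub_dotProduct H R⁻¹ y x).hasFDerivAt
  have hSu : ∀ x u, fderiv ℝ S x u = ((Hᵀ * R⁻¹) *ᵥ (H *ᵥ x - y)) ⬝ᵥ u :=
    fderiv_half_mulVec_sub_dotProduct H R⁻¹ hA y
  have hVd : ∀ x, HasFDerivAt V
      (((m : ℝ) / 2) • (fderiv ℝ S ((1 / (m : ℝ)) • ∑ j, x j)).comp
          ((1 / (m : ℝ)) • ∑ j, ContinuousLinearMap.proj (R := ℝ) (φ := fun _ => Fin n → ℝ) j) +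
        (1 / 2 : ℝ) • ∑ j, (fderiv ℝ S (x j)).comp (ContinuousLinearMap.proj j)) x := fun x => by
    rw [funext hV]
    have hproj : ∀ j, HasFDerivAt (fun x : Fin m → Fin n → ℝ => x j)
        (ContinuousLinearMap.proj (R := ℝ) j) x := fun j => hasFDerivAt_apply j x
    have hmean : HasFDerivAt (fun x : Fin m → Fin n → ℝ => (1 / (m : ℝ)) • ∑ j, x j) _ x :=
      (HasFDerivAt.fun_sum fun j _ => hproj j).const_smul (1 / (m : ℝ))
    exact (((hS _).comp x hmean).const_mul ((m : ℝ) / 2)).add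
      ((HasFDerivAt.fun_sum fun j _ => (hS (x j)).comp x (hproj j)).const_mul (1 / 2))
  refine ⟨fun x => (hVd x).differentiableAt, fun x i u => ?_⟩
  have hm0 : (m : ℝ) ≠ 0 := by positivity
  have hVx := hVd (Function.update x i (x i))
  have hcomp := hVx.comp (x i) (hasFDerivAt_update x (x i))
  have hsingle : ∀ j, (Pi.single i (ContinuousLinearMap.id ℝ (Fin n → ℝ)) :
      Fin m → (Fin n → ℝ) →L[ℝ] (Fin n → ℝ)) j u = if j = i then u else 0 := fun j => by
    by_cases h : j = i
    · subst h; simp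
    · simp [h]
  have hfd : fderiv ℝ (fun v => V (Function.update x i v)) (x i) = _ := hcomp.fderiv
  rw [hfd]
  simp only [Function.update_eq_self, ContinuousLinearMap.comp_apply,
    _root_.add_apply, _root_.smul_apply, _root_.sum_apply,
    ContinuousLinearMap.proj_apply, ContinuousLinearMap.pi_apply, hsingle, Finset.sum_ite_eq',
    apply_ite, Finset.mem_univ, if_true, hSu, dotProduct_zero,
    smul_dotProduct, add_dotProduct, dotProduct_smul, smul_eq_mul]
  field_simp
  ring
end

section
/- Let H be a k×n real matrix, R a k×k real symmetric positive definite matrix, y ∈ ℝ^k, and m ≥ 2. Suppose x₁,…,x_m : ℝ → ℝⁿ are differentiable and satisfy dxᵢ/ds = −(1/2) P(s) [ Hᵀ R⁻¹ (H xᵢ(s) − y) + Hᵀ R⁻¹ (H x̄(s) − y) ] for all i, where x̄(s) = (1/m) Σᵢ xᵢ(s) and P(s) = (1/(m−1)) Σᵢ (xᵢ(s) − x̄(s))(xᵢ(s) − x̄(s))ᵀ. Then each ensemble deviation eᵢ(s) = xᵢ(s) − x̄(s) is differentiable and satisfies deᵢ/ds = −(1/2) P(s) Hᵀ R⁻¹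 H eᵢ(s). -/
open Matrix

/-- Along solutions of the continuous ensemble Kalman analysis
equations, each ensemble deviation `eᵢ(s) = xᵢ(s) - x̄(s)` satisfies
`deᵢ/ds = -(1/2) P(s) Hᵀ R⁻¹ H eᵢ(s)`. -/
theorem ensemble_ode_deviation_equation
    {n k : ℕ} (H : Matrix (Fin k) (Fin n) ℝ) (R : Matrix (Fin k) (Fin k) ℝ)
    (y : Fin k → ℝ) (hR : R.PosDef)
    (m : ℕ) (hm : 2 ≤ m)
    (x : Fin m → ℝ → Fin n → ℝ) (hx : ∀ i, Differentiable ℝ (x i))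
    (xbar : ℝ → Fin n → ℝ) (hxbar : ∀ s, xbar s = (1 / (m : ℝ)) • ∑ i, x i s)
    (P : ℝ → Matrix (Fin n) (Fin n) ℝ)
    (hP : ∀ s, P s = (1 / ((m : ℝ) - 1)) •
      ∑ i, vecMulVec (x i s - xbar s) (x i s - xbar s))
    (hode : ∀ (i : Fin m) (s : ℝ),
      HasDerivAt (x i)
        (-(1 / 2 : ℝ) • (P s).mulVec
          ((Hᵀ * R⁻¹).mulVec (H.mulVec (x i s) - y) +
           (Hᵀ * R⁻¹).mulVec (H.mulVec (xbar s) - y))) s) :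
    ∀ (i : Fin m) (s : ℝ),
      HasDerivAt (fun t => x i t - xbar t)
        (-(1 / 2 : ℝ) • (P s * Hᵀ * R⁻¹ * H).mulVec (x i s - xbar s)) s := by
  have hm0 : (m : ℝ) ≠ 0 := by
    have : m ≠ 0 := by omega
    exact_mod_cast this
  intro i s
  set A : Matrix (Fin n) (Fin n) ℝ := P s * Hᵀ * R⁻¹ * H with hA
  set c : Fin n → ℝ := -(1 / 2 : ℝ) • (A *ᵥ xbar s - (2 : ℝ) • (P s * Hᵀ * R⁻¹) *ᵥ y) with hc
  have hx' (j : Fin m) : HasDerivAt (x j) (-(1 / 2 : ℝ) • A *ᵥ x j s + c) s := by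
    refine (hode j s).congr_deriv ?_
    simp only [hc, hA, mulVec_add, mulVec_sub, mulVec_mulVec, ← Matrix.mul_assoc]
    module
  have hmean : HasDerivAt xbar (-(1 / 2 : ℝ) • A *ᵥ xbar s + c) s := by
    rw [funext hxbar]
    refine ((HasDerivAt.fun_sum fun j (_ : j ∈ Finset.univ) => hx' j).fun_const_smul
      (1 / (m : ℝ))).congr_deriv ?_
    simp only [Finset.sum_add_distrib, ← Finset.smul_sum, ← mulVec_sum, mulVec_smul,
      Finset.sum_const, Finset.card_univ, Fintype.card_fin, smul_add,
      ← Nat.cast_smul_eq_nsmul ℝ, smul_smul]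
    rw [one_div_mul_cancel hm0, one_smul, mul_comm]
  refine ((hx' i).fun_sub hmean).congr_deriv ?_
  rw [mulVec_sub]
  module
end

section
/- Let H be a k×n real matrix, R a k×k real symmetric positive definite matrix, y ∈ ℝ^k, and m ≥ 2. Suppose x₁,…,x_m : [0,1] → ℝⁿ are differentiable and satisfy dxᵢ/ds = −(1/2) P(s) [ Hᵀ R⁻¹ (H xᵢ(s) − y) + Hᵀ R⁻¹ (H x̄(s) − y) ] for all i on [0,1], where x̄(s) = (1/m) Σᵢ xᵢ(s) and P(s) = (1/(m−1)) Σᵢ (xᵢ(s) − x̄(s))(xᵢ(s) − x̄(s))ᵀ. Write x̄_f = x̄(0), P_f = P(0), and K = P_f Hᵀ (H P_f Hᵀ + R)⁻¹. Then at fictitious time s = 1 the ensemble reproduces the Kalman analysis step exactly: x̄(1) = x̄_f − K (H x̄_f − y) and P(1) = (I − K H) P_f. -/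
open Matrix

section Riccati

variable {𝔸 : Type*} [NormedRing 𝔸] [NormedAlgebra ℝ 𝔸]

/-- A solution of the Riccati equation `P' = -P S P` satisfies `P(s) (1 + s S P(0)) = P(0)`. -/
theorem riccati_mul_one_add_smul {P : ℝ → 𝔸} {S : 𝔸}
    (hP : ∀ s ∈ Set.Icc (0 : ℝ) 1, HasDerivAt P (-(P s * S * P s)) s) :
    ∀ s ∈ Set.Icc (0 : ℝ) 1, P s * (1 + s • (S * P 0)) = P 0 := by
  have hcont : ContinuousOn P (Set.Icc 0 1) := fun s hs =>
    (hP s hs).continuousAt.continuousWithinAt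
  obtain ⟨C, hC⟩ := isCompact_Icc.exists_bound_of_continuousOn
    (hcont.mul (continuousOn_const (c := S)))
  have hderiv : ∀ s ∈ Set.Icc (0 : ℝ) 1,
      HasDerivAt (fun s => P s * (1 + s • (S * P 0)) - P 0)
        (-(P s * S) * (P s * (1 + s • (S * P 0)) - P 0)) s := by
    intro s hs
    have h := ((hP s hs).mul
      (((hasDerivAt_id s).smul_const (S * P 0)).const_add 1)).sub_const (P 0)
    refine h.congr_deriv ?_
    simp only [id, one_smul]
    noncomm_ring
  intro s hs
  exact sub_eq_zero.mp (eq_zero_of_abs_deriv_le_mul_abs_self_of_eq_zero_right (K := C)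
    (fun t ht => (hderiv t ht).continuousAt.continuousWithinAt)
    (fun t ht => (hderiv t (Set.Ico_subset_Icc_self ht)).hasDerivWithinAt)
    (by simp)
    (fun t ht => by
      refine (norm_mul_le _ _).trans ?_
      rw [norm_neg]
      exact mul_le_mul_of_nonneg_right (hC t (Set.Ico_subset_Icc_self ht)) (norm_nonneg _))
    s hs)

end Riccati

section MatrixRiccati

open scoped Matrix.Norms.Operator

/-- Matrix form of `riccati_mul_one_add_smul`, with the equation stated entrywise. -/
theorem matrix_riccati_mul_one_add_smul {n : Type*} [Fintype n] [DecidableEq n]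
    {P : ℝ → Matrix n n ℝ} {S : Matrix n n ℝ}
    (hP : ∀ s ∈ Set.Icc (0 : ℝ) 1, ∀ a b,
      HasDerivAt (fun t => P t a b) (-(P s * S * P s) a b) s) :
    ∀ s ∈ Set.Icc (0 : ℝ) 1, P s * (1 + s • (S * P 0)) = P 0 := by
  refine riccati_mul_one_add_smul fun s hs => ?_
  have h : HasDerivAt (fun t a => P t a) (fun a => (-(P s * S * P s)) a) s :=
    hasDerivAt_pi.2 fun a => hasDerivAt_pi.2 fun b => hP s hs a b
  exact h

end MatrixRiccati

/-- Derivative of a scaled sum of outer products of curves `eᵢ` with `eᵢ' = M eᵢ`. -/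
theorem hasDerivAt_smul_sum_vecMulVec {ι n : Type*} [Fintype ι] [Fintype n]
    {e : ι → ℝ → n → ℝ} {M : Matrix n n ℝ} {s : ℝ} (c : ℝ)
    (he : ∀ i, HasDerivAt (e i) (M *ᵥ e i s) s) (a b : n) :
    HasDerivAt (fun t => (c • ∑ i, vecMulVec (e i t) (e i t)) a b)
      ((M * (c • ∑ i, vecMulVec (e i s) (e i s)) +
        (c • ∑ i, vecMulVec (e i s) (e i s)) * Mᵀ) a b) s := by
  have hsum : HasDerivAt (fun t => c * ∑ i, e i t a * e i t b)
      (c * ∑ i, ((M *ᵥ e i s) a * e i s b + e i s a * (M *ᵥ e i s) b)) s :=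
    (HasDerivAt.fun_sum fun i _ =>
      (hasDerivAt_pi.1 (he i) a).mul (hasDerivAt_pi.1 (he i) b)).const_mul c
  convert hsum using 1
  · ext t
    simp [Matrix.sum_apply, vecMulVec_apply]
  · rw [Matrix.mul_smul, Matrix.smul_mul, ← smul_add, Matrix.mul_sum, Matrix.sum_mul,
      ← Finset.sum_add_distrib]
    simp [Matrix.sum_apply, mul_vecMulVec, vecMulVec_mul, vecMul_transpose, vecMulVec_apply]

/-- Curves of the form `v' = -P (S v - b)`, with `(1 + s P₀ S) P(s) = P₀`, satisfy
`(1 + s P₀ S) v(s) = v(0) + s P₀ b`. -/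
theorem one_add_smul_mulVec_eq {n : Type*} [Fintype n] [DecidableEq n]
    {P : ℝ → Matrix n n ℝ} {P₀ S : Matrix n n ℝ} {v : ℝ → n → ℝ} {b : n → ℝ}
    (hP : ∀ s ∈ Set.Icc (0 : ℝ) 1, (1 + s • (P₀ * S)) * P s = P₀)
    (hv : ∀ s ∈ Set.Icc (0 : ℝ) 1, HasDerivAt v (-(P s *ᵥ (S *ᵥ v s - b))) s) :
    ∀ s ∈ Set.Icc (0 : ℝ) 1, (1 + s • (P₀ * S)) *ᵥ v s = v 0 + s • (P₀ *ᵥ b) := by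
  have hderiv : ∀ s ∈ Set.Icc (0 : ℝ) 1,
      HasDerivAt (fun t => v t + t • ((P₀ * S) *ᵥ v t) - t • (P₀ *ᵥ b)) 0 s := by
    intro s hs
    have hL : HasDerivAt (fun t => (P₀ * S) *ᵥ v t)
        ((P₀ * S) *ᵥ (-(P s *ᵥ (S *ᵥ v s - b)))) s :=
      (Matrix.mulVecLin (P₀ * S)).toContinuousLinearMap.hasFDerivAt.comp_hasDerivAt s (hv s hs)
    have h := ((hv s hs).add ((hasDerivAt_id s).smul hL)).sub
      ((hasDerivAt_id s).smul_const (P₀ *ᵥ b))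
    refine h.congr_deriv ?_
    have key := congrArg (fun A => A *ᵥ (S *ᵥ v s - b)) (hP s hs)
    simp only [Matrix.add_mul, Matrix.one_mul, Matrix.smul_mul, Matrix.add_mulVec,
      Matrix.smul_mulVec, Matrix.mulVec_sub, ← Matrix.mulVec_mulVec] at key
    simp only [id, one_smul, Matrix.mulVec_neg, Matrix.mulVec_sub, smul_neg,
      smul_sub, ← Matrix.mulVec_mulVec] at key ⊢
    linear_combination -key
  intro s hs
  have h := constant_of_has_deriv_right_zero
    (fun t ht => (hderiv t ht).continuousAt.continuousWithinAt)
    (fun t ht => (hderiv t (Set.Ico_subset_Icc_self ht)).hasDerivWithinAt) s hs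
  simp only [zero_smul, add_zero, sub_zero] at h
  rw [Matrix.add_mulVec, Matrix.one_mulVec, Matrix.smul_mulVec, ← h]
  abel

section KalmanGain

variable {n k : Type*} [Fintype n] [DecidableEq n] [Fintype k] [DecidableEq k]
  {H : Matrix k n ℝ} {R : Matrix k k ℝ} {P : Matrix n n ℝ}

theorem one_sub_kalmanGain_mul_one_add (hR : IsUnit R.det) (hW : IsUnit (H * P * Hᵀ + R).det) :
    (1 - P * Hᵀ * (H * P * Hᵀ + R)⁻¹ * H) * (1 + P * (Hᵀ * R⁻¹ * H)) = 1 := by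
  have h : H * (1 + P * (Hᵀ * R⁻¹ * H)) = (H * P * Hᵀ + R) * (R⁻¹ * H) := by
    rw [Matrix.add_mul, ← Matrix.mul_assoc R, Matrix.mul_nonsing_inv _ hR]
    simp only [Matrix.mul_add, Matrix.mul_assoc, Matrix.mul_one, Matrix.one_mul]
    abel
  rw [Matrix.sub_mul, Matrix.mul_assoc _ H, h, Matrix.mul_assoc _ _ (_ * (_ * H)),
    Matrix.nonsing_inv_mul_cancel_left _ _ hW]
  simp only [Matrix.mul_assoc, Matrix.one_mul]
  abel

theorem one_sub_kalmanGain_mul_forecast (hR : IsUnit R.det)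
    (hW : IsUnit (H * P * Hᵀ + R).det) :
    (1 - P * Hᵀ * (H * P * Hᵀ + R)⁻¹ * H) * P * (Hᵀ * R⁻¹) =
      P * Hᵀ * (H * P * Hᵀ + R)⁻¹ := by
  set K := P * Hᵀ * (H * P * Hᵀ + R)⁻¹ with hK
  have h : K * (H * P * Hᵀ + R) = P * Hᵀ := Matrix.nonsing_inv_mul_cancel_right _ _ hW
  have h' : (1 - K * H) * P * Hᵀ = K * R := by
    rw [Matrix.sub_mul, Matrix.sub_mul, Matrix.one_mul, ← h]
    simp only [Matrix.mul_add, Matrix.mul_assoc]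
    abel
  rw [← Matrix.mul_assoc, h', Matrix.mul_nonsing_inv_cancel_right _ _ hR]

end KalmanGain



/-- Solving the continuous ensemble Kalman analysis equations
over the unit fictitious-time interval [0,1] reproduces the Kalman analysis
step exactly: with `x̄_f = x̄(0)`, `P_f = P(0)` and
`K = P_f Hᵀ (H P_f Hᵀ + R)⁻¹`, one has `x̄(1) = x̄_f - K (H x̄_f - y)` and
`P(1) = (I - K H) P_f`. -/
theorem ensemble_ode_reproduces_kalman_step
    {n k : ℕ} (H : Matrix (Fin k) (Fin n) ℝ) (R : Matrix (Fin k) (Fin k) ℝ)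
    (y : Fin k → ℝ) (hR : R.PosDef)
    (m : ℕ) (hm : 2 ≤ m)
    (x : Fin m → ℝ → Fin n → ℝ)
    (xbar : ℝ → Fin n → ℝ) (hxbar : ∀ s, xbar s = (1 / (m : ℝ)) • ∑ i, x i s)
    (P : ℝ → Matrix (Fin n) (Fin n) ℝ)
    (hP : ∀ s, P s = (1 / ((m : ℝ) - 1)) •
      ∑ i, vecMulVec (x i s - xbar s) (x i s - xbar s))
    (hode : ∀ (i : Fin m), ∀ s ∈ Set.Icc (0 : ℝ) 1,
      HasDerivAt (x i)
        (-(1 / 2 : ℝ) • (P s).mulVec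
          ((Hᵀ * R⁻¹).mulVec (H.mulVec (x i s) - y) +
           (Hᵀ * R⁻¹).mulVec (H.mulVec (xbar s) - y))) s)
    (K : Matrix (Fin n) (Fin k) ℝ)
    (hK : K = P 0 * Hᵀ * (H * P 0 * Hᵀ + R)⁻¹) :
    xbar 1 = xbar 0 - K.mulVec (H.mulVec (xbar 0) - y) ∧
      P 1 = (1 - K * H) * P 0 := by
  have hm0 : (m : ℝ) ≠ 0 := by
    have : m ≠ 0 := by omega
    exact_mod_cast this
  have hm1 : 0 ≤ 1 / ((m : ℝ) - 1) := by
    have : (2 : ℝ) ≤ m := by exact_mod_cast hm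
    exact one_div_nonneg.2 (by linarith)
  set S := Hᵀ * R⁻¹ * H with hS
  set b := (Hᵀ * R⁻¹) *ᵥ y with hb
  have hRt : Rᵀ = R := by simpa using hR.isHermitian.eq
  have hSt : Sᵀ = S := by
    simp only [hS, Matrix.transpose_mul, Matrix.transpose_transpose,
      Matrix.transpose_nonsing_inv, hRt, Matrix.mul_assoc]
  have hPsd : ∀ s, (P s).PosSemidef := fun s => by
    rw [hP s]
    exact (Matrix.posSemidef_sum _ fun i _ => by
      simpa using Matrix.posSemidef_vecMulVec_self_star (x i s - xbar s)).smul hm1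
  have hPt : ∀ s, (P s)ᵀ = P s := fun s => by simpa using (hPsd s).isHermitian.eq
  have hx : ∀ i, ∀ s ∈ Set.Icc (0 : ℝ) 1, HasDerivAt (x i)
      (-(1 / 2 : ℝ) • P s *ᵥ ((S *ᵥ x i s - b) + (S *ᵥ xbar s - b))) s := by
    intro i s hs
    simpa only [hS, hb, Matrix.mulVec_sub, Matrix.mulVec_mulVec] using hode i s hs
  have hmean : ∀ s, ∑ i, x i s = (m : ℝ) • xbar s := fun s => by
    rw [hxbar s, smul_smul, mul_one_div_cancel hm0, one_smul]
  have hxb : ∀ s ∈ Set.Icc (0 : ℝ) 1,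
      HasDerivAt xbar (-(P s *ᵥ (S *ᵥ xbar s - b))) s := by
    intro s hs
    rw [funext hxbar]
    refine ((HasDerivAt.fun_sum fun i _ => hx i s hs).const_smul (1 / (m : ℝ))).congr_deriv ?_
    rw [← funext hxbar, ← Finset.smul_sum, ← Matrix.mulVec_sum, Finset.sum_add_distrib,
      Finset.sum_sub_distrib, ← Matrix.mulVec_sum, hmean]
    simp only [Finset.sum_const, Finset.card_univ, Fintype.card_fin, Matrix.mulVec_smul,
      ← Nat.cast_smul_eq_nsmul ℝ, ← smul_sub, ← smul_add]
    rw [← two_smul ℝ, Matrix.mulVec_smul]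
    match_scalars
    field_simp
  have he : ∀ s ∈ Set.Icc (0 : ℝ) 1, ∀ i, HasDerivAt (fun t => x i t - xbar t)
      ((-(1 / 2 : ℝ) • (P s * S)) *ᵥ (x i s - xbar s)) s := by
    intro s hs i
    refine ((hx i s hs).sub (hxb s hs)).congr_deriv ?_
    simp only [Matrix.smul_mulVec, ← Matrix.mulVec_mulVec, Matrix.mulVec_sub, Matrix.mulVec_add]
    module
  have hdP : ∀ s ∈ Set.Icc (0 : ℝ) 1, ∀ a c,
      HasDerivAt (fun t => P t a c) (-(P s * S * P s) a c) s := by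
    intro s hs a c
    have h := hasDerivAt_smul_sum_vecMulVec (1 / ((m : ℝ) - 1)) (he s hs) a c
    simp only [← hP] at h
    refine h.congr_deriv ?_
    rw [← Matrix.neg_apply]
    refine congrArg (fun A : Matrix (Fin n) (Fin n) ℝ => A a c) ?_
    simp only [Matrix.transpose_smul, Matrix.transpose_mul, hSt, hPt, Matrix.smul_mul,
      Matrix.mul_smul, Matrix.mul_assoc]
    module
  have hPS : ∀ s ∈ Set.Icc (0 : ℝ) 1, (1 + s • (P 0 * S)) * P s = P 0 := fun s hs => by
    simpa [Matrix.transpose_mul, hPt, hSt] using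
      congrArg Matrix.transpose (matrix_riccati_mul_one_add_smul hdP s hs)
  have hone : (1 : ℝ) ∈ Set.Icc (0 : ℝ) 1 := by simp
  have hPone := hPS 1 hone
  have hxone := one_add_smul_mulVec_eq hPS hxb 1 hone
  have hRu : IsUnit R.det := hR.det_pos.ne'.isUnit
  have hWu : IsUnit (H * P 0 * Hᵀ + R).det := by
    have h := (hPsd 0).mul_mul_conjTranspose_same H
    rw [Matrix.conjTranspose_eq_transpose_of_trivial] at h
    exact (hR.posSemidef_add h).det_pos.ne'.isUnit
  have hinv := one_sub_kalmanGain_mul_one_add hRu hWu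
  have hgain := one_sub_kalmanGain_mul_forecast hRu hWu
  rw [← hK] at hinv hgain
  rw [← hS] at hinv
  rw [one_smul] at hPone
  rw [one_smul, one_smul] at hxone
  constructor
  · have h := congrArg (fun v => (1 - K * H) *ᵥ v) hxone
    simp only [Matrix.mulVec_mulVec, hinv, Matrix.one_mulVec, Matrix.mulVec_add, hb,
      ← Matrix.mul_assoc _ (P 0), hgain] at h
    rw [h, Matrix.sub_mulVec, Matrix.one_mulVec, Matrix.mulVec_sub, Matrix.mulVec_mulVec]
    abel
  · rw [← hPone, ← Matrix.mul_assoc, hinv, Matrix.one_mul]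
end

section
/- Let S : ℝⁿ → ℝ be a differentiable cost function with gradient ∇S, let m ≥ 1, and let A : ℝ → ℝ^{n×n} be a family of symmetric positive semidefinite matrices (for example, a Schur-product localized covariance P̃(s) = C_loc ∘ P(s)). Suppose x₁,…,x_m : ℝ → ℝⁿ are differentiable and satisfy dxᵢ/ds = −(1/2) A(s) [ ∇S(xᵢ(s)) + ∇S(x̄(s)) ] for all i, where x̄(s) = (1/m) Σᵢ xᵢ(s). Then the function φ(s) = S(x̄(s)) + (1/m) Σᵢ S(xᵢ(s)) is differentiable with φ'(s) ≤ 0 for all s; in particular φ is nonincreasing. -/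
open Matrix

/-- For an arbitrary differentiable cost `S : ℝⁿ → ℝ` with
gradient `∇S`, a family `A(s)` of symmetric positive semidefinite matrices
(e.g. a Schur-product localized covariance), and ensemble members satisfying
`dxᵢ/ds = -(1/2) A(s) [∇S(xᵢ) + ∇S(x̄)]`, the function
`φ(s) = S(x̄(s)) + (1/m) Σᵢ S(xᵢ(s))` is differentiable with nonpositive
derivative; in particular `φ` is nonincreasing. -/
theorem localized_ensemble_ode_cost_decays
    {n : ℕ} (S : (Fin n → ℝ) → ℝ) (gradS : (Fin n → ℝ) → Fin n → ℝ)
    (hSdiff : Differentiable ℝ S)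
    (hgrad : ∀ (x : Fin n → ℝ) (u : Fin n → ℝ), fderiv ℝ S x u = gradS x ⬝ᵥ u)
    (m : ℕ) (hm : 1 ≤ m)
    (A : ℝ → Matrix (Fin n) (Fin n) ℝ) (hA : ∀ s, (A s).PosSemidef)
    (x : Fin m → ℝ → Fin n → ℝ)
    (xbar : ℝ → Fin n → ℝ) (hxbar : ∀ s, xbar s = (1 / (m : ℝ)) • ∑ i, x i s)
    (hode : ∀ (i : Fin m) (s : ℝ),
      HasDerivAt (x i)
        (-(1 / 2 : ℝ) • (A s).mulVec (gradS (x i s) + gradS (xbar s))) s)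
    (φ : ℝ → ℝ)
    (hφ : ∀ s, φ s = S (xbar s) + (1 / (m : ℝ)) * ∑ i, S (x i s)) :
    (∀ s : ℝ, ∃ d : ℝ, HasDerivAt φ d s ∧ d ≤ 0) ∧ Antitone φ := by
  have hS (c : ℝ → Fin n → ℝ) (v : Fin n → ℝ) (s : ℝ) (hc : HasDerivAt c v s) :
      HasDerivAt (fun t ↦ S (c t)) (gradS (c s) ⬝ᵥ v) s := by
    rw [← hgrad]
    exact (hSdiff (c s)).hasFDerivAt.comp_hasDerivAt s hc
  have hderiv (s : ℝ) : ∃ d : ℝ, HasDerivAt φ d s ∧ d ≤ 0 := by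
    have hbar : HasDerivAt xbar ((1 / (m : ℝ)) •
        ∑ i, -(1 / 2 : ℝ) • (A s) *ᵥ (gradS (x i s) + gradS (xbar s))) s := by
      exact ((HasDerivAt.fun_sum fun i _ ↦ hode i s).const_smul
        (1 / (m : ℝ))).congr_of_eventuallyEq (.of_forall hxbar)
    have hφ' := (hS xbar _ s hbar).add
      ((HasDerivAt.fun_sum fun i (_ : i ∈ Finset.univ) ↦
        hS (x i) _ s (hode i s)).const_mul (1 / (m : ℝ)))
    refine ⟨_, hφ'.congr_of_eventuallyEq (.of_forall hφ), ?_⟩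
    rw [dotProduct_smul, dotProduct_sum, smul_eq_mul, ← mul_add, ← Finset.sum_add_distrib]
    refine mul_nonpos_of_nonneg_of_nonpos (by positivity) (Finset.sum_nonpos fun i _ ↦ ?_)
    rw [← add_dotProduct, add_comm (gradS (xbar s)), dotProduct_smul, smul_eq_mul]
    have hnonneg := (hA s).dotProduct_mulVec_nonneg (gradS (x i s) + gradS (xbar s))
    rw [star_trivial] at hnonneg
    linarith
  refine ⟨hderiv, ?_⟩
  choose d hd hd_nonpos using hderiv
  exact antitone_of_hasDerivAt_nonpos hd hd_nonpos
end
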